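/- arXiv:math/0205087 — 2 statements merged into one kernel-verified Lean document; each statement's English description precedes it below -/
import Mathlib

section
/- For every integer n ≥ 0, δ10(single_n(1) + Σ_{j=0}^{n−1} single_j(𝔘_j^n)) = single_0((−1)^{n+1} · T_λ(u^{n+1})). (Lemma 2.2.3: the boundary of the element x^n y^{n+1} e₁ + Σ_{j=0}^{n−1} 𝔘_j^n(t) x^j y^{j+1} e₁ equals (−1)^{n+1} T_λ(u^{n+1})(t) x^0 y^0.) -/
open Polynomial

/-- `T μ P = P(t+μ) − P(t)`, the difference operator of Section 2.2 of
Guccione–Guccione, "Hochschild homology of iterated skew polynomial rings". -/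
noncomputable def Tdiff {k : Type*} [Field k] (μ : k) (P : k[X]) : k[X] :=
  P.comp (X + C μ) - P

open scoped Classical in
/-- `𝔘_j^n = (−1)^{n−j} Σ_{0 ≤ i₁ ≤ ⋯ ≤ i_{n−j} ≤ j+1} u(t+i₁λ)⋯u(t+i_{n−j}λ)`,
the sum running over weakly increasing sequences of `n−j` integers between `0`
and `j+1` (so `𝔘_n^n = 1`). -/
noncomputable def Ufrak {k : Type*} [Field k] (u : k[X]) (lam : k) (n : ℕ) (j : ℤ) : k[X] :=
  (-1) ^ (((n : ℤ) - j).toNat) *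
    ∑ f ∈ Finset.univ.filter
        (fun f : Fin (((n : ℤ) - j).toNat) → Fin ((j + 2).toNat) => Monotone f),
      ∏ l, u.comp (X + C (((f l : ℕ) : k) * lam))

open scoped Classical in
/-- Complete homogeneous sums over weakly increasing sequences. -/
noncomputable def Hsum {R : Type*} [CommRing R] (m N : ℕ) (w : Fin N → R) : R :=
  ∑ f ∈ Finset.univ.filter (fun f : Fin m → Fin N => Monotone f), ∏ l, w (f l)

theorem Hsum_zero {R : Type*} [CommRing R] (N : ℕ) (w : Fin N → R) : Hsum 0 N w = 1 := by
  classical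
  unfold Hsum
  rw [Finset.filter_true_of_mem (p := fun f : Fin 0 → Fin N => Monotone f)
    (fun f _ => fun a => a.elim0)]
  simp

theorem Hsum_one {R : Type*} [CommRing R] (m : ℕ) (w : Fin 1 → R) : Hsum m 1 w = w 0 ^ m := by
  classical
  unfold Hsum
  rw [Finset.filter_true_of_mem (p := fun f : Fin m → Fin 1 => Monotone f)
    (fun f _ => fun a b _ => (Subsingleton.elim _ _).le)]
  simp

theorem Hsum_rev {R : Type*} [CommRing R] (m N : ℕ) (w : Fin N → R) :
    Hsum m N (fun i => w i.rev) = Hsum m N w := by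
  classical
  unfold Hsum
  refine Finset.sum_bij' (fun f _ => fun i => (f i.rev).rev) (fun f _ => fun i => (f i.rev).rev)
    ?_ ?_ ?_ ?_ ?_
  · intro f hf
    simp only [Finset.mem_filter, Finset.mem_univ, true_and] at hf ⊢
    intro a b hab
    exact Fin.rev_le_rev.2 (hf (Fin.rev_le_rev.2 hab))
  · intro f hf
    simp only [Finset.mem_filter, Finset.mem_univ, true_and] at hf ⊢
    intro a b hab
    exact Fin.rev_le_rev.2 (hf (Fin.rev_le_rev.2 hab))
  · intro f hf
    simp
  · intro f hf
    simp
  · intro f hf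
    exact (Equiv.prod_comp Fin.revPerm (fun l => w (f l).rev)).symm

theorem Hsum_first {R : Type*} [CommRing R] (m N : ℕ) (w : Fin (N + 1) → R) :
    Hsum (m + 1) (N + 1) w = Hsum (m + 1) N (fun i => w i.succ) + w 0 * Hsum m (N + 1) w := by
  classical
  unfold Hsum
  rw [← Finset.sum_filter_not_add_sum_filter _ (fun f => f 0 = 0), Finset.mul_sum]
  congr 1
  · symm
    refine Finset.sum_bij (fun f _ => fun i => (f i).succ) ?_ ?_ ?_ ?_
    · intro f hf
      simp only [Finset.mem_filter, Finset.mem_univ, true_and] at hf ⊢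
      exact ⟨fun a b hab => Fin.succ_le_succ_iff.2 (hf hab), Fin.succ_ne_zero _⟩
    · intro f _ g _ h
      funext i
      exact Fin.succ_injective _ (congrFun h i)
    · intro f hf
      simp only [Finset.mem_filter, Finset.mem_univ, true_and] at hf
      have hne : ∀ i, f i ≠ 0 := by
        intro i hi
        apply hf.2
        have := hf.1 (Fin.zero_le i)
        rw [hi] at this
        exact le_antisymm this (Fin.zero_le _)
      refine ⟨fun i => (f i).pred (hne i), ?_, ?_⟩
      · simp only [Finset.mem_filter, Finset.mem_univ, true_and]
        intro a b hab
        exact Fin.pred_le_pred_iff.2 (hf.1 hab)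
      · funext i
        simp
    · intro f _
      rfl
  · symm
    refine Finset.sum_bij (fun f _ => (Fin.cons 0 f : Fin (m + 1) → Fin (N + 1))) ?_ ?_ ?_ ?_
    · intro f hf
      simp only [Finset.mem_filter, Finset.mem_univ, true_and] at hf ⊢
      refine ⟨?_, by simp⟩
      intro a b hab
      induction a using Fin.cases with
      | zero => simp
      | succ a =>
        induction b using Fin.cases with
        | zero => exact absurd hab (by simp [Fin.le_def])
        | succ b => simpa using hf (Fin.succ_le_succ_iff.1 hab)
    · intro f _ g _ h
      exact Fin.cons_right_injective (α := fun _ => Fin (N + 1)) 0 h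
    · intro f hf
      simp only [Finset.mem_filter, Finset.mem_univ, true_and] at hf
      refine ⟨Fin.tail f, ?_, ?_⟩
      · simp only [Finset.mem_filter, Finset.mem_univ, true_and]
        intro a b hab
        exact hf.1 (Fin.succ_le_succ_iff.2 hab)
      · rw [← hf.2]
        exact Fin.cons_self_tail f
    · intro f _
      simp [Fin.prod_univ_succ]

theorem Hsum_last {R : Type*} [CommRing R] (m N : ℕ) (w : Fin (N + 1) → R) :
    Hsum (m + 1) (N + 1) w =
      Hsum (m + 1) N (fun i => w i.castSucc) + w (Fin.last N) * Hsum m (N + 1) w := by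
  have h := Hsum_first m N (fun i => w i.rev)
  rw [Hsum_rev (m + 1) (N + 1) w, Hsum_rev m (N + 1) w] at h
  simp only [Fin.rev_succ, Fin.rev_zero] at h
  rw [Hsum_rev (m + 1) N (fun i => w i.castSucc)] at h
  exact h

/-- The key identity. -/
theorem Hsum_key {R : Type*} [CommRing R] (m N : ℕ) (v : ℕ → R) :
    Hsum (m + 1) N (fun i => v (i + 1)) - Hsum (m + 1) N (fun i => v i) =
      (v N - v 0) * Hsum m (N + 1) (fun i => v i) := by
  have h1 := Hsum_first m N (fun i => v i)
  have h2 := Hsum_last m N (fun i => v i)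
  simp only [Fin.val_succ, Fin.val_castSucc, Fin.val_last, Fin.val_zero] at h1 h2
  linear_combination h2 - h1

theorem Hsum_map {R : Type*} [CommRing R] (φ : R →+* R) (m N : ℕ) (w : Fin N → R) :
    φ (Hsum m N w) = Hsum m N (fun i => φ (w i)) := by
  simp [Hsum, map_sum, map_prod]

theorem Ufrak_eq {k : Type*} [Field k] (u : k[X]) (lam : k) (n j : ℕ) :
    Ufrak u lam n (j : ℤ) =
      (-1) ^ (n - j) * Hsum (n - j) (j + 2) (fun i => u.comp (X + C (((i : ℕ) : k) * lam))) := by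
  have key : ∀ a b a' b' : ℕ, a = a' → b = b' →
      (-1) ^ a * Hsum a b (fun i => u.comp (X + C (((i : ℕ) : k) * lam))) =
      (-1) ^ a' * Hsum a' b' (fun i => u.comp (X + C (((i : ℕ) : k) * lam))) := by
    rintro a b _ _ rfl rfl
    rfl
  exact key _ _ _ _ (by omega) (by omega)

theorem Hsum_shift {k : Type*} [Field k] (u : k[X]) (lam : k) (m N : ℕ) :
    Tdiff lam (Hsum (m + 1) N (fun i => u.comp (X + C (((i : ℕ) : k) * lam)))) =
      Tdiff ((N : k) * lam) u *
        Hsum m (N + 1) (fun i => u.comp (X + C (((i : ℕ) : k) * lam))) := by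
  have h := Hsum_key m N (fun i : ℕ => u.comp (X + C ((i : k) * lam)))
  have h2 := Hsum_map (compRingHom (X + C lam)) (m + 1) N
    (fun i => u.comp (X + C (((i : ℕ) : k) * lam)))
  simp only [coe_compRingHom_apply] at h2
  have h3 : ∀ i : ℕ, (u.comp (X + C ((i : k) * lam))).comp (X + C lam) =
      u.comp (X + C (((i + 1 : ℕ) : k) * lam)) := by
    intro i
    rw [comp_assoc]
    congr 1
    simp only [add_comp, X_comp, C_comp, Nat.cast_add, Nat.cast_one, add_mul, one_mul, C_add]
    ring
  simp only [h3] at h2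
  unfold Tdiff
  rw [h2, h]
  simp

theorem Tdiff_sign {k : Type*} [Field k] (mu : k) (m : ℕ) (P : k[X]) :
    Tdiff mu ((-1) ^ m * P) = (-1) ^ m * Tdiff mu P := by
  simp [Tdiff, mul_sub]

theorem Ufrak_step {k : Type*} [Field k] (u : k[X]) (lam : k) (n j : ℕ) (hj : j < n) :
    Tdiff lam (Ufrak u lam n (j : ℤ)) =
      -(Ufrak u lam n ((j + 1 : ℕ) : ℤ) * Tdiff ((((j + 1 : ℕ) : k) + 1) * lam) u) := by
  obtain ⟨m, rfl⟩ : ∃ m, n = j + 1 + m := ⟨n - (j + 1), by omega⟩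
  rw [Ufrak_eq, Ufrak_eq, Tdiff_sign, show j + 1 + m - j = m + 1 by omega,
    show j + 1 + m - (j + 1) = m by omega, Hsum_shift]
  have : ((j + 2 : ℕ) : k) = ((j + 1 : ℕ) : k) + 1 := by push_cast; ring
  rw [this]
  ring

theorem Ufrak_self {k : Type*} [Field k] (u : k[X]) (lam : k) (n : ℕ) :
    Ufrak u lam n (n : ℤ) = 1 := by
  rw [Ufrak_eq, Nat.sub_self, Hsum_zero]
  simp

theorem Ufrak_zero_mul {k : Type*} [Field k] (u : k[X]) (lam : k) (n : ℕ) :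
    -(Ufrak u lam n ((0 : ℕ) : ℤ) * Tdiff ((((0 : ℕ) : k) + 1) * lam) u) =
      (-1) ^ (n + 1) * Tdiff lam (u ^ (n + 1)) := by
  have h := Hsum_shift u lam n 1
  rw [Hsum_one] at h
  simp only [Fin.val_zero, Nat.cast_zero, zero_mul, C_0, add_zero, comp_X, Nat.cast_one,
    one_mul] at h
  rw [Ufrak_eq, h]
  simp only [Nat.sub_zero, Nat.cast_zero, zero_add, one_mul]
  ring

/-- Lemma 2.2.3 of Guccione–Guccione: for the boundary map `δ₁₀` of the double
complex `W_{**}(E)` (on the summand `⊕_{j≥0} k[t]·x^j y^{j+1} e₁`, modelled as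
`ℕ →₀ k[t]`), one has
`δ₁₀(x^n y^{n+1} e₁ + Σ_{j<n} 𝔘_j^n x^j y^{j+1} e₁) = (−1)^{n+1} T_λ(u^{n+1}) x⁰y⁰`. -/
theorem stmt8 {k : Type*} [Field k] [CharZero k] (lam : k) (hlam : lam ≠ 0)
    (u : k[X])
    (D : (ℕ →₀ k[X]) →ₗ[k] (ℕ →₀ k[X]))
    (hD : ∀ (j : ℕ) (Q : k[X]),
      D (Finsupp.single j Q) =
        -Finsupp.single (j + 1) (Tdiff lam Q) -
          Finsupp.single j (Q * Tdiff (((j : k) + 1) * lam) u))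
    (n : ℕ) :
    D (Finsupp.single n 1 +
        ∑ j ∈ Finset.range n, Finsupp.single j (Ufrak u lam n (j : ℤ))) =
      Finsupp.single 0 ((-1) ^ (n + 1) * Tdiff lam (u ^ (n + 1))) := by
  have hstep : ∀ j ∈ Finset.range n, D (Finsupp.single j (Ufrak u lam n (j : ℤ))) =
      Finsupp.single (j + 1)
          (Ufrak u lam n ((j + 1 : ℕ) : ℤ) * Tdiff ((((j + 1 : ℕ) : k) + 1) * lam) u) -
        Finsupp.single j (Ufrak u lam n (j : ℤ) * Tdiff (((j : k) + 1) * lam) u) := by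
    intro j hj
    rw [hD, Ufrak_step u lam n j (Finset.mem_range.1 hj), Finsupp.single_neg, neg_neg]
  rw [map_add, map_sum, Finset.sum_congr rfl hstep,
    Finset.sum_range_sub (fun j : ℕ => (Finsupp.single j
      (Ufrak u lam n (j : ℤ) * Tdiff (((j : k) + 1) * lam) u) : ℕ →₀ k[X])) n,
    hD, Ufrak_self, ← Ufrak_zero_mul, Finsupp.single_neg]
  have h1 : Tdiff lam (1 : k[X]) = 0 := by simp [Tdiff]
  rw [h1, Finsupp.single_zero]
  abel
end

section
/- Assume u ∉ k (u is not a constant polynomial). Then the kernel of the k-linear map δ11 equals the k-linear span of {𝔙_n : n ≥ 0}. (Part of Lemma 2.2.6: H_1(W_{*1}(E)) = H_2(W_{*1}(E)) = ⊕_{n≥0} k·𝔙_n.) -/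
open Polynomial

/-- `𝔙_n = x^n y^n e₁e₂ + Σ_{j=0}^{n−1} 𝔘_{j−1}^{n−1}(t+λ) x^j y^j e₁e₂`,
modelled in `ℕ →₀ k[t]`. -/
noncomputable def Vfrak {k : Type*} [Field k] (u : k[X]) (lam : k) (n : ℕ) :
    ℕ →₀ k[X] :=
  Finsupp.single n 1 +
    ∑ j ∈ Finset.range n,
      Finsupp.single j ((Ufrak u lam (n - 1) ((j : ℤ) - 1)).comp (X + C lam))

open scoped Classical in
/-- complete homogeneous sum over monotone maps -/
noncomputable def hsumAux {R : Type*} [CommRing R] (g : ℕ → R) (m q : ℕ) : R :=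
  ∑ f ∈ Finset.univ.filter (fun f : Fin m → Fin q => Monotone f), ∏ l, g (f l : ℕ)

theorem hsumAux_zero {R : Type*} [CommRing R] (g : ℕ → R) (q : ℕ) : hsumAux g 0 q = 1 := by
  classical
  unfold hsumAux
  rw [Finset.filter_true_of_mem]
  · simp
  · intro f _ a
    exact a.elim0

theorem hsumAux_first {R : Type*} [CommRing R] (g : ℕ → R) (m q : ℕ) :
    hsumAux g (m + 1) (q + 1) =
      g 0 * hsumAux g m (q + 1) + hsumAux (fun i => g (i + 1)) (m + 1) q := by
  classical
  unfold hsumAux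
  rw [← Finset.sum_filter_add_sum_filter_not _ (fun f : Fin (m + 1) → Fin (q + 1) => f 0 = 0)]
  congr 1
  · rw [Finset.mul_sum]
    symm
    refine Finset.sum_bij (fun f _ => (Fin.cons 0 f : Fin (m + 1) → Fin (q + 1))) ?_ ?_ ?_ ?_
    · intro f hf
      simp only [Finset.mem_filter, Finset.mem_univ, true_and] at hf ⊢
      refine ⟨?_, by simp⟩
      intro a b hab
      induction a using Fin.cases with
      | zero => simp
      | succ a =>
        induction b using Fin.cases with
        | zero => simp at hab
        | succ b => simpa using hf (Fin.succ_le_succ_iff.1 hab)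
    · intro a _ b _ h
      funext l
      simpa using congrFun h l.succ
    · intro f hf
      simp only [Finset.mem_filter, Finset.mem_univ, true_and] at hf
      refine ⟨Fin.tail f, ?_, ?_⟩
      · simp only [Finset.mem_filter, Finset.mem_univ, true_and]
        intro a b hab
        exact hf.1 (Fin.succ_le_succ_iff.2 hab)
      · rw [← hf.2]; exact Fin.cons_self_tail f
    · intro f _
      rw [Fin.prod_univ_succ]
      simp
  · symm
    refine Finset.sum_bij (fun f _ l => (f l).succ) ?_ ?_ ?_ ?_
    · intro f hf
      simp only [Finset.mem_filter, Finset.mem_univ, true_and] at hf ⊢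
      exact ⟨fun a b hab => Fin.succ_le_succ_iff.2 (hf hab), Fin.succ_ne_zero _⟩
    · intro a _ b _ h
      funext l
      exact Fin.succ_injective _ (congrFun h l)
    · intro f hf
      simp only [Finset.mem_filter, Finset.mem_univ, true_and] at hf
      have hne : ∀ l, f l ≠ 0 := fun l h => hf.2 (by
        have := hf.1 (Fin.zero_le l)
        rw [h] at this
        exact Fin.le_zero_iff.1 this)
      refine ⟨fun l => (f l).pred (hne l), ?_, ?_⟩
      · simp only [Finset.mem_filter, Finset.mem_univ, true_and]
        intro a b hab
        exact Fin.pred_le_pred_iff.2 (hf.1 hab)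
      · funext l; simp
    · intro f _
      simp

theorem hsumAux_last {R : Type*} [CommRing R] (g : ℕ → R) (m q : ℕ) :
    hsumAux g (m + 1) (q + 1) =
      g q * hsumAux g m (q + 1) + hsumAux g (m + 1) q := by
  classical
  unfold hsumAux
  rw [← Finset.sum_filter_add_sum_filter_not _
    (fun f : Fin (m + 1) → Fin (q + 1) => f (Fin.last m) = Fin.last q)]
  congr 1
  · rw [Finset.mul_sum]
    symm
    refine Finset.sum_bij
      (fun f _ => (Fin.snoc f (Fin.last q) : Fin (m + 1) → Fin (q + 1))) ?_ ?_ ?_ ?_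
    · intro f hf
      simp only [Finset.mem_filter, Finset.mem_univ, true_and] at hf ⊢
      refine ⟨?_, by simp⟩
      intro a b hab
      induction b using Fin.lastCases with
      | last => simp [Fin.le_last]
      | cast b =>
        induction a using Fin.lastCases with
        | last => exact absurd hab (not_le.2 (Fin.castSucc_lt_last b))
        | cast a => simpa using hf (Fin.castSucc_le_castSucc_iff.1 hab)
    · intro a _ b _ h
      funext l
      simpa using congrFun h l.castSucc
    · intro f hf
      simp only [Finset.mem_filter, Finset.mem_univ, true_and] at hf
      refine ⟨Fin.init f, ?_, ?_⟩
      · simp only [Finset.mem_filter, Finset.mem_univ, true_and]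
        intro a b hab
        exact hf.1 (Fin.castSucc_le_castSucc_iff.2 hab)
      · rw [← hf.2]; exact Fin.snoc_init_self f
    · intro f _
      rw [Fin.prod_univ_castSucc]
      simp [mul_comm]
  · symm
    refine Finset.sum_bij (fun f _ l => (f l).castSucc) ?_ ?_ ?_ ?_
    · intro f hf
      simp only [Finset.mem_filter, Finset.mem_univ, true_and] at hf ⊢
      exact ⟨fun a b hab => Fin.castSucc_le_castSucc_iff.2 (hf hab), (Fin.castSucc_lt_last _).ne⟩
    · intro a _ b _ h
      funext l
      exact Fin.castSucc_injective _ (congrFun h l)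
    · intro f hf
      simp only [Finset.mem_filter, Finset.mem_univ, true_and] at hf
      have hne : ∀ l, f l ≠ Fin.last q := fun l h => hf.2 (by
        have := hf.1 (Fin.le_last l)
        rw [h] at this
        exact Fin.last_le_iff.1 this)
      refine ⟨fun l => (f l).castPred (hne l), ?_, ?_⟩
      · simp only [Finset.mem_filter, Finset.mem_univ, true_and]
        intro a b hab
        exact Fin.castPred_le_castPred_iff.2 (hf.1 hab)
      · funext l; simp
    · intro f _
      simp

theorem hsumAux_diff {R : Type*} [CommRing R] (g : ℕ → R) (m q : ℕ) :
    hsumAux (fun i => g (i + 1)) (m + 1) q - hsumAux g (m + 1) q =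
      (g q - g 0) * hsumAux g m (q + 1) := by
  have h1 := hsumAux_first g m q
  have h2 := hsumAux_last g m q
  linear_combination h2 - h1

theorem hsumAux_map {R S : Type*} [CommRing R] [CommRing S] (φ : R →+* S) (g : ℕ → R) (m q : ℕ) :
    φ (hsumAux g m q) = hsumAux (fun i => φ (g i)) m q := by
  simp [hsumAux, map_sum, map_prod]

/-- shifted copies of `u` -/
noncomputable def gAux {k : Type*} [Field k] (u : k[X]) (lam : k) (i : ℕ) : k[X] :=
  u.comp (X + C (((i : k) + 1) * lam))

theorem gAux_shift {k : Type*} [Field k] (u : k[X]) (lam : k) (i : ℕ) :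
    (gAux u lam i).comp (X + C lam) = gAux u lam (i + 1) := by
  unfold gAux
  rw [comp_assoc]
  congr 1
  simp only [add_comp, X_comp, C_comp, Nat.cast_add, Nat.cast_one]
  rw [add_assoc, ← C_add]
  congr 2
  ring

theorem hsum_comp {k : Type*} [Field k] (u : k[X]) (lam : k) (m q : ℕ) :
    (hsumAux (gAux u lam) m q).comp (X + C lam) =
      hsumAux (fun i => gAux u lam (i + 1)) m q := by
  have := hsumAux_map (compRingHom (X + C lam)) (gAux u lam) m q
  simpa only [coe_compRingHom_apply, gAux_shift] using this

theorem Ufrak_comp {k : Type*} [Field k] (u : k[X]) (lam : k) (j m : ℕ) :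
    (Ufrak u lam (j + m) ((j : ℤ) - 1)).comp (X + C lam) =
      (-1) ^ (m + 1) * hsumAux (gAux u lam) (m + 1) (j + 1) := by
  have e1 : (((j + m : ℕ) : ℤ) - ((j : ℤ) - 1)).toNat = m + 1 := by omega
  have e2 : (((j : ℤ) - 1) + 2).toNat = j + 1 := by omega
  unfold Ufrak
  rw [e1, e2, mul_comp]
  congr 1
  · simp
  · have := hsumAux_map (compRingHom (X + C lam))
      (fun i : ℕ => u.comp (X + C ((i : k) * lam))) (m + 1) (j + 1)
    simp only [coe_compRingHom_apply] at this
    refine Eq.trans this ?_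
    congr 1
    funext i
    unfold gAux
    rw [comp_assoc]
    congr 1
    simp only [add_comp, X_comp, C_comp]
    rw [add_assoc, ← C_add]
    congr 2
    ring

/-- coefficients of `Vfrak` -/
noncomputable def cAux {k : Type*} [Field k] (u : k[X]) (lam : k) (n j : ℕ) : k[X] :=
  if j ≤ n then (-1) ^ (n - j) * hsumAux (gAux u lam) (n - j) (j + 1) else 0

theorem Vfrak_apply {k : Type*} [Field k] (u : k[X]) (lam : k) (n j : ℕ) :
    Vfrak u lam n j = cAux u lam n j := by
  classical
  unfold Vfrak cAux
  rw [Finsupp.add_apply, Finsupp.finset_sum_apply]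
  simp only [Finsupp.single_apply]
  rw [Finset.sum_ite_eq' (Finset.range n) j]
  rcases lt_trichotomy j n with h | h | h
  · obtain ⟨m, rfl⟩ := Nat.exists_eq_add_of_lt h
    have e : j + m + 1 - 1 = j + m := rfl
    have e' : j + m + 1 - j = m + 1 := by omega
    rw [if_neg (by omega), if_pos (by simpa using h), if_pos h.le, e, e', Ufrak_comp, zero_add]
  · subst h
    simp [hsumAux_zero]
  · rw [if_neg (by omega), if_neg (by simp; omega), if_neg (by omega), zero_add]

theorem cAux_rel {k : Type*} [Field k] (u : k[X]) (lam : k) (n j : ℕ) :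
    Tdiff lam (cAux u lam n j) +
      cAux u lam n (j + 1) * (Tdiff (((j : k) + 1) * lam) u).comp (X + C lam) = 0 := by
  have hT : (Tdiff (((j : k) + 1) * lam) u).comp (X + C lam) =
      gAux u lam (j + 1) - gAux u lam 0 := by
    rw [← gAux_shift]
    simp [Tdiff, gAux]
  rw [hT]
  unfold Tdiff cAux
  rcases lt_trichotomy j n with h | h | h
  · obtain ⟨m, rfl⟩ := Nat.exists_eq_add_of_lt h
    have e : j + m + 1 - (j + 1) = m := by omega
    have e' : j + m + 1 - j = m + 1 := by omega
    rw [if_pos h.le, if_pos (by omega), e, e', mul_comp, hsum_comp]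
    have := hsumAux_diff (gAux u lam) m (j + 1)
    have h1 : ((-1 : k[X]) ^ (m + 1)).comp (X + C lam) = (-1) ^ (m + 1) := by simp
    rw [h1, pow_succ]
    linear_combination (-(-1) ^ m) * this
  · subst h
    simp [hsumAux_zero]
  · rw [if_neg (by omega), if_neg (by omega)]
    simp

theorem Tdiff_zero_const {k : Type*} [Field k] [CharZero k] (lam : k) (hlam : lam ≠ 0)
    (P : k[X]) (h : Tdiff lam P = 0) : P = C (P.eval 0) := by
  have hp : P.comp (X + C lam) = P := sub_eq_zero.1 h
  have h1 : ∀ n : ℕ, P.eval ((n : k) * lam) = P.eval 0 := by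
    intro n
    induction n with
    | zero => simp
    | succ n ih =>
      rw [← ih]
      conv_rhs => rw [← hp]
      simp [add_mul]
  apply Polynomial.eq_of_infinite_eval_eq
  refine Set.Infinite.mono (s := Set.range (fun n : ℕ => (n : k) * lam)) ?_ ?_
  · rintro _ ⟨n, rfl⟩
    simp [h1]
  · apply Set.infinite_range_of_injective
    intro a b hab
    exact Nat.cast_injective (mul_right_cancel₀ hlam hab)

theorem Tdiff_zero' {k : Type*} [Field k] (lam : k) : Tdiff lam (0 : k[X]) = 0 := by
  simp [Tdiff]

theorem Tdiff_add' {k : Type*} [Field k] (lam : k) (P Q : k[X]) :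
    Tdiff lam (P + Q) = Tdiff lam P + Tdiff lam Q := by
  simp only [Tdiff, add_comp]; ring

/-- Part of Lemma 2.2.6 of Guccione–Guccione: if `u ∉ k`, the kernel of the
boundary map `δ₁₁` of `W_{**}(E)` equals the `k`-linear span of the elements
`𝔙_n`, `n ≥ 0`. -/
theorem stmt14 {k : Type*} [Field k] [CharZero k] (lam : k) (hlam : lam ≠ 0)
    (u : k[X]) (hu : ∀ c : k, u ≠ C c)
    (D : (ℕ →₀ k[X]) →ₗ[k] (ℕ →₀ k[X]))
    (hD0 : ∀ Q : k[X], D (Finsupp.single 0 Q) = -Finsupp.single 0 (Tdiff lam Q))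
    (hD : ∀ (j : ℕ) (Q : k[X]),
      D (Finsupp.single (j + 1) Q) =
        -Finsupp.single (j + 1) (Tdiff lam Q) -
          Finsupp.single j (Q * (Tdiff (((j : k) + 1) * lam) u).comp (X + C lam))) :
    LinearMap.ker D = Submodule.span k (Set.range (Vfrak u lam)) := by
  classical
  have hDa : ∀ (w : ℕ →₀ k[X]) (j : ℕ), D w j = -(Tdiff lam (w j) +
      w (j + 1) * (Tdiff (((j : k) + 1) * lam) u).comp (X + C lam)) := by
    intro w j
    induction w using Finsupp.induction_linear with
    | zero => simp [Tdiff_zero']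
    | add f g hf hg =>
      rw [map_add, Finsupp.add_apply, hf, hg, Finsupp.add_apply, Finsupp.add_apply, Tdiff_add']
      ring
    | single i Q =>
      rcases i with _ | i
      · rw [hD0]
        by_cases h : j = 0
        · subst h; simp
        · simp [Finsupp.single_apply, Ne.symm h, Tdiff_zero']
      · rw [hD]
        simp only [Finsupp.sub_apply, Finsupp.neg_apply, Finsupp.single_apply]
        by_cases h1 : i + 1 = j
        · subst h1
          simp
        · by_cases h2 : i = j
          · subst h2
            simp [Tdiff_zero']
          · simp [h1, h2, Tdiff_zero']
  have hV : ∀ n, Vfrak u lam n ∈ LinearMap.ker D := by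
    intro n
    rw [LinearMap.mem_ker]
    ext1 j
    rw [hDa, Vfrak_apply, Vfrak_apply, cAux_rel]
    simp
  apply le_antisymm
  · have key : ∀ (N : ℕ) (w : ℕ →₀ k[X]), w ∈ LinearMap.ker D → (∀ j, N ≤ j → w j = 0) →
        w ∈ Submodule.span k (Set.range (Vfrak u lam)) := by
      intro N
      induction N with
      | zero =>
        intro w _ h
        have : w = 0 := by ext1 j; simpa using h j (Nat.zero_le j)
        rw [this]; exact Submodule.zero_mem _
      | succ N ih =>
        intro w hw h
        have h0 : Tdiff lam (w N) = 0 := by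
          have := hDa w N
          rw [LinearMap.mem_ker.1 hw, h (N + 1) le_rfl] at this
          simpa using this.symm
        have hc := Tdiff_zero_const lam hlam _ h0
        set c := (w N).eval 0
        have hVs : c • Vfrak u lam N ∈ Submodule.span k (Set.range (Vfrak u lam)) :=
          Submodule.smul_mem _ _ (Submodule.subset_span ⟨N, rfl⟩)
        have h2 : w - c • Vfrak u lam N ∈ Submodule.span k (Set.range (Vfrak u lam)) := by
          apply ih
          · exact Submodule.sub_mem _ hw (Submodule.smul_mem _ _ (hV N))
          · intro j hj
            rw [Finsupp.sub_apply, Finsupp.smul_apply, Vfrak_apply]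
            rcases hj.eq_or_lt with rfl | hj
            · rw [hc]
              simp [cAux, hsumAux_zero, smul_eq_C_mul]
            · rw [h j hj]
              simp [cAux, not_le.2 hj]
        simpa using Submodule.add_mem _ h2 hVs
    intro w hw
    apply key (w.support.sup id + 1) w hw
    intro j hj
    by_contra hne
    have : j ≤ w.support.sup id :=
      Finset.le_sup (f := id) (Finsupp.mem_support_iff.2 hne)
    omega
  · rw [Submodule.span_le]
    rintro _ ⟨n, rfl⟩
    exact hV n
end
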